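/- Let H be a Hopf algebra over a field k, let B be a left H-module algebra with action ▷, and let e be a central idempotent of B. Then A = eB is a unital algebra with unit e, and the map h·a := e(h▷a) for h ∈ H, a ∈ A is a symmetric left partial action of H on A, i.e. it satisfies (PLA1), (PLA2), (PLA3) and (PLA3') with 1_A = e. -/

import Mathlib

open TensorProduct

/-- `sw2 k f g` is the Sweedler-style map `h ↦ ∑ f(h₍₁₎) * g(h₍₂₎)`. -/
noncomputable def sw2 (k : Type*) [Field k] {H A : Type*}
    [AddCommGroup H] [Module k H] [Coalgebra k H]
    [Ring A] [Algebra k A] (f g : H →ₗ[k] A) : H →ₗ[k] A :=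
  TensorProduct.lift ((LinearMap.mul k A).compl₁₂ f g) ∘ₗ Coalgebra.comul

/-- Scaling both factors of a Sweedler product by a central idempotent scales the product. -/
theorem sw2_eq_mul_sw2 {k H A : Type*} [Field k] [AddCommGroup H] [Module k H] [Coalgebra k H]
    [Ring A] [Algebra k A] {e : A} (he : e * e = e) (hcentral : ∀ a : A, e * a = a * e)
    {f g f' g' : H →ₗ[k] A} (hf : ∀ x, f x = e * f' x) (hg : ∀ x, g x = e * g' x) (h : H) :
    sw2 k f g h = e * sw2 k f' g' h := by
  have key : TensorProduct.lift ((LinearMap.mul k A).compl₁₂ f g) =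
      LinearMap.mulLeft k e ∘ₗ TensorProduct.lift ((LinearMap.mul k A).compl₁₂ f' g') := by
    ext x y
    simp only [TensorProduct.AlgebraTensorModule.curry_apply, TensorProduct.curry_apply,
      LinearMap.restrictScalars_self, LinearMap.comp_apply,
      TensorProduct.lift.tmul, LinearMap.compl₁₂_apply, LinearMap.mul_apply',
      LinearMap.mulLeft_apply, hf, hg]
    rw [mul_assoc, ← mul_assoc (f' x), ← hcentral (f' x), mul_assoc e, ← mul_assoc e e, he]
  simp only [sw2, LinearMap.comp_apply, key, LinearMap.mulLeft_apply]

/-- Let `B` be a left `H`-module algebra and `e` a central idempotent of `B`. Then `A = eB`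
is a unital algebra with unit `e`, and `h·a := e(h▷a)` is a symmetric left partial action of
`H` on `A`, i.e. it satisfies (PLA1), (PLA2), (PLA3) and (PLA3') with `1_A = e`. -/
theorem centralIdempotent_induces_symmPartialAction
    {k H B : Type*} [Field k] [Ring H] [HopfAlgebra k H] [Ring B] [Algebra k B]
    (mact : H →ₗ[k] B →ₗ[k] B)
    -- `B` is a left `H`-module algebra:
    (hma1 : ∀ b : B, mact 1 b = b)
    (hma2 : ∀ (h g : H) (b : B), mact h (mact g b) = mact (h * g) b)
    (hma3 : ∀ (h : H) (b b' : B), mact h (b * b') = sw2 k (mact.flip b) (mact.flip b') h)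
    (hma4 : ∀ h : H, mact h 1 = algebraMap k B (Coalgebra.counit h))
    -- `e` is a central idempotent:
    (e : B) (he : e * e = e) (hcentral : ∀ b : B, e * b = b * e)
    -- the induced map `h·a = e(h▷a)`:
    (pact : H →ₗ[k] B →ₗ[k] B)
    (hpact : ∀ (h : H) (b : B), pact h b = e * mact h b) :
    -- `A = eB` is a unital algebra with unit `e`:
    (∀ a : B, e * a = a → (e * a = a ∧ a * e = a)) ∧
    -- the partial action takes values in `A = eB`:
    (∀ (h : H) (a : B), e * pact h a = pact h a) ∧
    -- (PLA1):
    (∀ a : B, e * a = a → pact 1 a = a) ∧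
    -- (PLA2):
    (∀ (h : H) (a b : B), e * a = a → e * b = b →
      pact h (a * b) = sw2 k (pact.flip a) (pact.flip b) h) ∧
    -- (PLA3), with `1_A = e`:
    (∀ (h g : H) (a : B), e * a = a →
      pact h (pact g a) = sw2 k (pact.flip e) (pact.flip a ∘ₗ LinearMap.mulRight k g) h) ∧
    -- (PLA3'), with `1_A = e`:
    (∀ (h g : H) (a : B), e * a = a →
      pact h (pact g a) = sw2 k (pact.flip a ∘ₗ LinearMap.mulRight k g) (pact.flip e) h) := by
  have hflip : ∀ (b : B) (x : H), pact.flip b x = e * mact.flip b x := fun b x => hpact x b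
  have hflip_mul : ∀ (g : H) (b : B) (x : H),
      (pact.flip b ∘ₗ LinearMap.mulRight k g) x = e * mact.flip (mact g b) x := fun g b x => by
    simp [hpact, hma2]
  refine ⟨fun a ha => ⟨ha, by rw [← hcentral, ha]⟩, fun h a => ?_, fun a ha => ?_,
    fun h a b _ _ => ?_, fun h g a _ => ?_, fun h g a _ => ?_⟩
  · rw [hpact, ← mul_assoc, he]
  · rw [hpact, hma1, ha]
  · rw [hpact, hma3, sw2_eq_mul_sw2 he hcentral (hflip a) (hflip b)]
  · rw [hpact, hpact, hma3, sw2_eq_mul_sw2 he hcentral (hflip e) (hflip_mul g a)]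
  · rw [hpact, hpact, hcentral (mact g a), hma3,
      sw2_eq_mul_sw2 he hcentral (hflip_mul g a) (hflip e)]
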